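/- Let G be a finite simple graph, let g, f be integer-valued functions on V(G) with 0 ≤ g(x) ≤ f(x) for every vertex x, and let m be a non-negative integer. Then G is a fractional (g,f,m)-deleted graph if and only if for every pair of disjoint vertex subsets S, T ⊆ V(G) and every set H of m edges of G, we have f(S) + d_{G−S}(T) − g(T) ≥ d_H(T) − e_H(T,S). -/

import Mathlib

open Classical Finset

/-- The fractional degree `d_G^h(x)` of a vertex: the sum of `h e` over all edges
(unordered pairs) containing `x`. -/
noncomputable def fracDeg {V : Type*} [Fintype V] [DecidableEq V]
    (h : Sym2 V → ℝ) (x : V) : ℝ :=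
  ∑ e ∈ Finset.univ.filter (fun e : Sym2 V => x ∈ e), h e

/-- `G` admits a fractional `(g,f)`-factor: a weighting `h : E(G) → [0,1]`
(extended by `0` off the edge set) with `g x ≤ d_G^h(x) ≤ f x` for every vertex. -/
def HasFracFactor {V : Type*} [Fintype V] [DecidableEq V]
    (G : SimpleGraph V) (g f : V → ℤ) : Prop :=
  ∃ h : Sym2 V → ℝ,
    (∀ e, 0 ≤ h e ∧ h e ≤ 1) ∧
    (∀ e, e ∉ G.edgeSet → h e = 0) ∧
    (∀ x : V, (g x : ℝ) ≤ fracDeg h x ∧ fracDeg h x ≤ (f x : ℝ))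

/-- `G` is a fractional `(g,f,m)`-deleted graph: after deleting any `m` edges,
the resulting graph admits a fractional `(g,f)`-factor. -/
def FracDeleted {V : Type*} [Fintype V] [DecidableEq V]
    (G : SimpleGraph V) (g f : V → ℤ) (m : ℕ) : Prop :=
  ∀ H : Finset (Sym2 V), ↑H ⊆ G.edgeSet → H.card = m →
    HasFracFactor (G.deleteEdges ↑H) g f

/-- `G` is a fractional `(g,f,n',m)`-critical deleted graph: after deleting any `n'`
vertices, the resulting induced graph is a fractional `(g,f,m)`-deleted graph. -/
def FracCriticalDeleted {V : Type*} [Fintype V] [DecidableEq V]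
    (G : SimpleGraph V) (g f : V → ℤ) (n' m : ℕ) : Prop :=
  ∀ U : Finset V, U.card = n' →
    FracDeleted (G.induce ((↑U : Set V)ᶜ)) (fun x => g x.1) (fun x => f x.1) m

/-- `G` is a fractional ID-`(g,f,m)`-deleted graph: after deleting any independent set
of vertices, the resulting induced graph is a fractional `(g,f,m)`-deleted graph. -/
def FracIDDeleted {V : Type*} [Fintype V] [DecidableEq V]
    (G : SimpleGraph V) (g f : V → ℤ) (m : ℕ) : Prop :=
  ∀ I : Set V, (∀ u ∈ I, ∀ v ∈ I, ¬ G.Adj u v) →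
    FracDeleted (G.induce Iᶜ) (fun x => g x.1) (fun x => f x.1) m

/-- The incidence map sending an edge weighting to its vector of fractional degrees. -/
noncomputable def fracDegLinear (V : Type*) [Fintype V] [DecidableEq V] :
    (Sym2 V → ℝ) →ₗ[ℝ] (V → ℝ) where
  toFun h := fracDeg h
  map_add' h k := by
    funext x
    simp [fracDeg, Finset.sum_add_distrib]
  map_smul' r h := by
    funext x
    simp [fracDeg, Finset.mul_sum]

theorem card_filter_mem_eq {V : Type*} [Fintype V] [DecidableEq V]
    (H : Finset (Sym2 V)) (x : V) :
    (H.filter (fun e => x ∈ e)).card = (univ.filter (fun y => s(x, y) ∈ H)).card := by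
  symm
  refine Finset.card_bij (fun y _ => s(x, y)) ?_ ?_ ?_
  · intro y hy
    simpa using hy
  · intro y _ z _ h
    exact Sym2.congr_right.1 h
  · intro e he
    obtain ⟨heH, y, rfl⟩ := Finset.mem_filter.1 he
    exact ⟨y, by simpa using heH, rfl⟩

theorem fracDeg_eq_sum {V : Type*} [Fintype V] [DecidableEq V]
    (h : Sym2 V → ℝ) (x : V) : fracDeg h x = ∑ y, h s(x, y) := by
  symm
  refine Finset.sum_bij (fun y _ => s(x, y)) ?_ ?_ ?_ ?_
  · intro y _
    simp
  · intro y _ z _ h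
    exact Sym2.congr_right.1 h
  · intro e he
    obtain ⟨_, y, rfl⟩ := Finset.mem_filter.1 he
    exact ⟨y, by simp, rfl⟩
  · simp

theorem card_filter_between_eq {V : Type*} [Fintype V] [DecidableEq V]
    (H : Finset (Sym2 V)) {S T : Finset V} (hST : Disjoint S T) :
    (H.filter (fun e => ∃ u ∈ T, ∃ v ∈ S, e = s(u, v))).card =
      ∑ x ∈ T, (univ.filter (fun y => s(x, y) ∈ H ∧ y ∈ S)).card := by
  rw [← Finset.card_sigma]
  symm
  refine Finset.card_bij (fun p _ => s(p.1, p.2)) ?_ ?_ ?_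
  · rintro ⟨x, y⟩ hp
    simp only [Finset.mem_sigma, Finset.mem_filter, Finset.mem_univ, true_and] at hp ⊢
    exact ⟨hp.2.1, x, hp.1, y, hp.2.2, rfl⟩
  · rintro ⟨x, y⟩ hp ⟨z, w⟩ hq h
    simp only [Finset.mem_sigma, Finset.mem_filter, Finset.mem_univ, true_and] at hp hq
    rcases Sym2.eq_iff.1 h with ⟨h1, h2⟩ | ⟨h1, h2⟩
    · dsimp only at h1 h2
      subst h1 h2
      rfl
    · dsimp only at h1 h2
      subst h1
      exact absurd hp.1 (Finset.disjoint_left.1 hST hq.2.2)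
  · intro e he
    obtain ⟨heH, u, hu, v, hv, rfl⟩ := Finset.mem_filter.1 he
    exact ⟨⟨u, v⟩, by simp [hu, hv, heH], rfl⟩

/-- `d_{G-H-S}(T) = d_{G-S}(T) - (d_H(T) - e_H(T,S))`. -/
theorem sum_card_deleteEdges_eq {V : Type*} [Fintype V] [DecidableEq V]
    (G : SimpleGraph V) [DecidableRel G.Adj] {H : Finset (Sym2 V)} (hH : ↑H ⊆ G.edgeSet)
    {S T : Finset V} (hST : Disjoint S T) :
    (∑ x ∈ T, ((univ.filter (fun y => (G.deleteEdges ↑H).Adj x y ∧ y ∉ S)).card : ℤ)) =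
      ∑ x ∈ T, ((G.neighborFinset x \ S).card : ℤ)
        - (∑ x ∈ T, ((H.filter (fun e => x ∈ e)).card : ℤ)
          - ((H.filter (fun e => ∃ u ∈ T, ∃ v ∈ S, e = s(u, v))).card : ℤ)) := by
  rw [card_filter_between_eq H hST]
  push_cast
  rw [← Finset.sum_sub_distrib, ← Finset.sum_sub_distrib]
  refine Finset.sum_congr rfl fun x _ => ?_
  rw [card_filter_mem_eq]
  have h1 : (G.neighborFinset x \ S).card =
      (univ.filter (fun y => (G.deleteEdges ↑H).Adj x y ∧ y ∉ S)).card +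
      (univ.filter (fun y => s(x, y) ∈ H ∧ y ∉ S)).card := by
    rw [← Finset.card_union_of_disjoint]
    · congr 1
      ext y
      have : s(x, y) ∈ H → G.Adj x y := fun h => hH h
      simp only [Finset.mem_sdiff, SimpleGraph.mem_neighborFinset, Finset.mem_union,
        Finset.mem_filter, Finset.mem_univ, true_and, SimpleGraph.deleteEdges_adj,
        Finset.mem_coe]
      tauto
    · rw [Finset.disjoint_left]
      intro y
      simp only [Finset.mem_filter, Finset.mem_univ, true_and, SimpleGraph.deleteEdges_adj,
        Finset.mem_coe]
      tauto
  have h2 : (univ.filter (fun y => s(x, y) ∈ H)).card =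
      (univ.filter (fun y => s(x, y) ∈ H ∧ y ∈ S)).card +
      (univ.filter (fun y => s(x, y) ∈ H ∧ y ∉ S)).card := by
    rw [← Finset.filter_filter, ← Finset.filter_filter, Finset.card_filter_add_card_filter_not]
  omega

theorem HasFracFactor.cut_nonneg {V : Type*} [Fintype V] [DecidableEq V]
    {G : SimpleGraph V} [DecidableRel G.Adj] {g f : V → ℤ}
    (hG : HasFracFactor G g f) (S T : Finset V) :
    0 ≤ ∑ x ∈ S, f x + ∑ x ∈ T, ((univ.filter (fun y => G.Adj x y ∧ y ∉ S)).card : ℤ)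
      - ∑ x ∈ T, g x := by
  obtain ⟨h, h01, h0, hd⟩ := hG
  have hT : ∀ x ∈ T, (g x : ℝ) ≤ ∑ y ∈ S, h s(x, y) +
      ((univ.filter (fun y => G.Adj x y ∧ y ∉ S)).card : ℝ) := by
    intro x _
    have h1 := (hd x).1
    rw [fracDeg_eq_sum, ← Finset.sum_add_sum_compl S] at h1
    refine h1.trans (add_le_add le_rfl ?_)
    have h2 : ∑ y ∈ Sᶜ, h s(x, y) ≤ ∑ y ∈ Sᶜ, if G.Adj x y then (1 : ℝ) else 0 := by
      refine Finset.sum_le_sum fun y _ => ?_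
      split_ifs with hxy
      · exact (h01 _).2
      · exact (h0 _ hxy).le
    refine h2.trans (le_of_eq ?_)
    rw [Finset.sum_boole]
    congr 2
    ext y
    simp [and_comm]
  have hS : ∀ y ∈ S, ∑ x ∈ T, h s(x, y) ≤ (f y : ℝ) := by
    intro y _
    have h1 := (hd y).2
    rw [fracDeg_eq_sum] at h1
    refine le_trans ?_ h1
    simp_rw [Sym2.eq_swap (a := y)]
    exact Finset.sum_le_sum_of_subset_of_nonneg (Finset.subset_univ _) fun _ _ _ => (h01 _).1
  have hT' := Finset.sum_le_sum hT
  have hS' := Finset.sum_le_sum hS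
  rw [Finset.sum_add_distrib, Finset.sum_comm] at hT'
  have : (0 : ℝ) ≤ ∑ x ∈ S, (f x : ℝ)
      + ∑ x ∈ T, ((univ.filter (fun y => G.Adj x y ∧ y ∉ S)).card : ℝ)
      - ∑ x ∈ T, (g x : ℝ) := by linarith
  exact_mod_cast this

/-- Integrating the cut condition over the level sets `{c ≤ -t}`, `{t ≤ c}`. -/
theorem cut_condition_weighted {V : Type*} [Fintype V] [DecidableEq V]
    {G : SimpleGraph V} [DecidableRel G.Adj] {g f : V → ℤ}
    (hcut : ∀ S T : Finset V, Disjoint S T →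
      0 ≤ ∑ x ∈ S, f x + ∑ x ∈ T, ((univ.filter (fun y => G.Adj x y ∧ y ∉ S)).card : ℤ)
        - ∑ x ∈ T, g x) (c : V → ℝ) :
    0 ≤ ∑ x, (f x : ℝ) * max (-c x) 0
      + ∑ x, ∑ y, (if G.Adj x y then max (c x - max 0 (-c y)) 0 else 0)
      - ∑ x, (g x : ℝ) * max (c x) 0 := by
  have hI : ∀ a b : ℝ, MeasureTheory.Integrable
      ((Set.Ioc a b).indicator (fun _ => (1 : ℝ))) := fun a b =>
    (MeasureTheory.integrable_indicator_iff measurableSet_Ioc).2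
      (MeasureTheory.integrableOn_const (by simp))
  have hV : ∀ a b : ℝ, ∫ t, (Set.Ioc a b).indicator (fun _ => (1 : ℝ)) t = max (b - a) 0 := by
    intro a b
    rw [MeasureTheory.integral_indicator measurableSet_Ioc]
    simp [MeasureTheory.Measure.real, ENNReal.toReal_ofReal']
  have hpos : ∀ t : ℝ, 0 ≤ ∑ x, (f x : ℝ) * (Set.Ioc 0 (-c x)).indicator (fun _ => (1 : ℝ)) t
      + ∑ x, ∑ y, (if G.Adj x y then (1 : ℝ) else 0) *
          (Set.Ioc (max 0 (-c y)) (c x)).indicator (fun _ => (1 : ℝ)) t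
      - ∑ x, (g x : ℝ) * (Set.Ioc 0 (c x)).indicator (fun _ => (1 : ℝ)) t := by
    intro t
    rcases le_or_gt t 0 with ht | ht
    · simp [Set.indicator, ht.not_gt]
    · have h1 := hcut (univ.filter fun x => c x ≤ -t) (univ.filter fun x => t ≤ c x) (by
        rw [Finset.disjoint_left]
        intro x hx hx'
        simp only [Finset.mem_filter, Finset.mem_univ, true_and] at hx hx'
        linarith)
      have h2 : (0 : ℝ) ≤ _ := Int.cast_nonneg (R := ℝ) h1
      push_cast at h2
      refine h2.trans (le_of_eq ?_)
      rw [Finset.sum_filter, Finset.sum_filter, Finset.sum_filter]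
      congr 1
      · congr 1
        · refine Finset.sum_congr rfl fun x _ => ?_
          simp [Set.indicator, ht, le_neg]
        · refine Finset.sum_congr rfl fun x _ => ?_
          rw [Finset.card_filter]
          push_cast
          split_ifs with hx
          · refine Finset.sum_congr rfl fun y _ => ?_
            by_cases hxy : G.Adj x y <;> simp [Set.indicator, ht, hx, hxy, neg_lt]
          · simp [Set.indicator, hx]
      · refine Finset.sum_congr rfl fun x _ => ?_
        simp [Set.indicator, ht]
  have hint := MeasureTheory.integral_nonneg (μ := MeasureTheory.volume) (Pi.le_def.2 hpos)
  rw [MeasureTheory.integral_sub, MeasureTheory.integral_add,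
    MeasureTheory.integral_finsetSum, MeasureTheory.integral_finsetSum,
    MeasureTheory.integral_finsetSum] at hint
  · simp_rw [MeasureTheory.integral_const_mul, hV, sub_zero] at hint
    refine hint.trans (le_of_eq ?_)
    congr 2
    refine Finset.sum_congr rfl fun x _ => ?_
    rw [MeasureTheory.integral_finsetSum _ fun y _ => (hI _ _).const_mul _]
    refine Finset.sum_congr rfl fun y _ => ?_
    rw [MeasureTheory.integral_const_mul, hV]
    simp
  · exact fun x _ => (hI _ _).const_mul _
  · exact fun x _ => MeasureTheory.integrable_finsetSum _ fun y _ => (hI _ _).const_mul _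
  · exact fun x _ => (hI _ _).const_mul _
  · exact MeasureTheory.integrable_finsetSum _ fun x _ => (hI _ _).const_mul _
  · exact MeasureTheory.integrable_finsetSum _ fun x _ =>
      MeasureTheory.integrable_finsetSum _ fun y _ => (hI _ _).const_mul _
  · exact (MeasureTheory.integrable_finsetSum _ fun x _ => (hI _ _).const_mul _).add
      (MeasureTheory.integrable_finsetSum _ fun x _ =>
        MeasureTheory.integrable_finsetSum _ fun y _ => (hI _ _).const_mul _)
  · exact MeasureTheory.integrable_finsetSum _ fun x _ => (hI _ _).const_mul _

theorem exists_weighting_sum_eq {V : Type*} [Fintype V] [DecidableEq V]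
    (G : SimpleGraph V) [DecidableRel G.Adj] (c : V → ℝ) :
    ∃ h : Sym2 V → ℝ, (∀ e, 0 ≤ h e ∧ h e ≤ 1) ∧ (∀ e, e ∉ G.edgeSet → h e = 0) ∧
      ∑ x, fracDeg h x * c x =
        ∑ x, ∑ y, (if G.Adj x y then max (c x - max 0 (-c y)) 0 else 0) := by
  refine ⟨fun e => if e ∈ G.edgeSet ∧
    0 < Sym2.lift ⟨fun x y => c x + c y, fun x y => add_comm _ _⟩ e then 1 else 0,
    ?_, ?_, ?_⟩
  · intro e
    dsimp only
    split_ifs <;> norm_num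
  · intro e he
    simp [he]
  · set w : V → V → ℝ := fun x y => if G.Adj x y ∧ 0 < c x + c y then 1 else 0 with hw
    set ψ : V → V → ℝ := fun x y => if G.Adj x y then max (c x - max 0 (-c y)) 0 else 0
    have h1 : ∑ x, ∑ y, w x y * c x + ∑ x, ∑ y, w x y * c y =
        ∑ x, ∑ y, ψ x y + ∑ x, ∑ y, ψ y x := by
      simp_rw [← Finset.sum_add_distrib]
      refine Finset.sum_congr rfl fun x _ => Finset.sum_congr rfl fun y _ => ?_
      by_cases hxy : G.Adj x y
      · simp only [hw, ψ, hxy, hxy.symm, true_and, if_true]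
        split_ifs <;> grind
      · have hyx : ¬ G.Adj y x := fun h => hxy h.symm
        simp [hw, ψ, hxy, hyx]
    have h2 : ∑ x, ∑ y, w x y * c y = ∑ x, ∑ y, w x y * c x := by
      rw [Finset.sum_comm]
      refine Finset.sum_congr rfl fun x _ => Finset.sum_congr rfl fun y _ => ?_
      simp only [hw, G.adj_comm y x, add_comm (c y)]
    have h3 : ∑ x, ∑ y, ψ y x = ∑ x, ∑ y, ψ x y := Finset.sum_comm
    have h4 : ∑ x, ∑ y, w x y * c x = ∑ x, ∑ y, ψ x y := by linarith
    rw [← h4]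
    refine Finset.sum_congr rfl fun x _ => ?_
    rw [fracDeg_eq_sum, Finset.sum_mul]
    simp [hw]

theorem HasFracFactor.of_cut_nonneg {V : Type*} [Fintype V] [DecidableEq V]
    {G : SimpleGraph V} [DecidableRel G.Adj] {g f : V → ℤ} (hgf : ∀ x, g x ≤ f x)
    (hcut : ∀ S T : Finset V, Disjoint S T →
      0 ≤ ∑ x ∈ S, f x + ∑ x ∈ T, ((univ.filter (fun y => G.Adj x y ∧ y ∉ S)).card : ℤ)
        - ∑ x ∈ T, g x) : HasFracFactor G g f := by
  set K : Set (Sym2 V → ℝ) := Set.Icc 0 (fun e => if e ∈ G.edgeSet then 1 else 0) with hK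
  set B : Set (V → ℝ) := Set.Icc (fun x => (g x : ℝ)) (fun x => (f x : ℝ))
  have hmem : ∀ h : Sym2 V → ℝ, h ∈ K ↔
      (∀ e, 0 ≤ h e ∧ h e ≤ 1) ∧ (∀ e, e ∉ G.edgeSet → h e = 0) := by
    intro h
    simp only [hK, Set.mem_Icc, Pi.le_def, Pi.zero_apply]
    constructor
    · rintro ⟨h0, h1⟩
      refine ⟨fun e => ⟨h0 e, (h1 e).trans ?_⟩, fun e he => le_antisymm ?_ (h0 e)⟩
      · split_ifs <;> norm_num
      · simpa [he] using h1 e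
    · rintro ⟨h0, h1⟩
      refine ⟨fun e => (h0 e).1, fun e => ?_⟩
      split_ifs with he
      · exact (h0 e).2
      · exact (h1 e he).le
  by_cases hdisj : Disjoint (fracDegLinear V '' K) B
  · exfalso
    have hcont : Continuous (fracDegLinear V) := LinearMap.continuous_of_finiteDimensional _
    obtain ⟨φ, u, v, hu, huv, hv⟩ := geometric_hahn_banach_compact_closed
      ((convex_Icc _ _).linear_image (fracDegLinear V)) (isCompact_Icc.image hcont)
      (convex_Icc _ _) isClosed_Icc hdisj
    set c : V → ℝ := fun x => φ (Pi.single x 1) with hc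
    have hφ : ∀ a : V → ℝ, φ a = ∑ x, a x * c x := by
      intro a
      conv_lhs => rw [pi_eq_sum_univ' a]
      simp [map_sum, hc, Pi.single]
    obtain ⟨h, h01, h0, hsum⟩ := exists_weighting_sum_eq G c
    have h1 := hu _ ⟨h, (hmem h).2 ⟨h01, h0⟩, rfl⟩
    have h2 := hv (fun x => if 0 ≤ c x then (g x : ℝ) else (f x : ℝ)) (by
      rw [Set.mem_Icc]
      refine ⟨fun x => ?_, fun x => ?_⟩ <;> dsimp only <;> split_ifs <;>
        first | exact le_rfl | exact_mod_cast hgf x)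
    rw [hφ] at h1 h2
    change ∑ x, fracDeg h x * c x < u at h1
    have h3 := cut_condition_weighted hcut c
    rw [hsum] at h1
    have h4 : ∑ x, (if 0 ≤ c x then (g x : ℝ) else (f x : ℝ)) * c x =
        ∑ x, (g x : ℝ) * max (c x) 0 - ∑ x, (f x : ℝ) * max (-c x) 0 := by
      rw [← Finset.sum_sub_distrib]
      refine Finset.sum_congr rfl fun x _ => ?_
      split_ifs with hx
      · rw [max_eq_left hx, max_eq_right (by linarith)]
        ring
      · rw [max_eq_right (by linarith), max_eq_left (by linarith)]
        ring
    linarith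
  · obtain ⟨_, ⟨h, hhK, rfl⟩, hhB⟩ := Set.not_disjoint_iff.1 hdisj
    exact ⟨h, ((hmem h).1 hhK).1, ((hmem h).1 hhK).2, fun x => ⟨hhB.1 x, hhB.2 x⟩⟩

theorem statement_12 {V : Type*} [Fintype V] [DecidableEq V]
    (G : SimpleGraph V) [DecidableRel G.Adj] (g f : V → ℤ) (m : ℕ)
    (hgf : ∀ x : V, 0 ≤ g x ∧ g x ≤ f x) :
    FracDeleted G g f m ↔
      ∀ S T : Finset V, Disjoint S T →
        ∀ H : Finset (Sym2 V), ↑H ⊆ G.edgeSet → H.card = m →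
          (∑ x ∈ S, f x) + ∑ x ∈ T, ((G.neighborFinset x \ S).card : ℤ) - (∑ x ∈ T, g x)
            ≥ ∑ x ∈ T, ((H.filter (fun e => x ∈ e)).card : ℤ)
              - ((H.filter (fun e => ∃ u ∈ T, ∃ v ∈ S, e = s(u, v))).card : ℤ) := by
  constructor
  · intro hG S T hST H hH hm
    have h1 := (hG H hH hm).cut_nonneg S T
    have h2 := sum_card_deleteEdges_eq G hH hST
    linarith
  · intro hcut H hH hm
    refine HasFracFactor.of_cut_nonneg (fun x => (hgf x).2) fun S T hST => ?_
    have h1 := hcut S T hST H hH hm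
    have h2 := sum_card_deleteEdges_eq G hH hST
    linarith
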